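/- arXiv:1705.10412 — 2 statements merged into one kernel-verified Lean document; each statement's English description precedes it below -/
import Mathlib

section
/- There exist absolute constants c > 0 and C > 0 such that for every sufficiently large dimension d there exists a twice continuously differentiable function f : ℝ^d → ℝ that is B-bounded, ℓ-gradient Lipschitz and ρ-Hessian Lipschitz with B, ℓ, ρ ≤ C·d^C, and a value ε ≥ 1/(C·d^C), such that if x^(0) is sampled uniformly at random from [−1,1]^d then, with probability one, no gradient descent iterate x^(t) with step size η ≤ 1/ℓ and t ≤ e^{c·d} is an ε-second-order stationary point of f. -/
open MeasureTheory ProbabilityTheory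

/-- Gradient descent iterates with step size `η` started at `x0`. -/
noncomputable def gdIter {E : Type*} [NormedAddCommGroup E] [InnerProductSpace ℝ E]
    [CompleteSpace E] (f : E → ℝ) (η : ℝ) (x0 : E) : ℕ → E
  | 0 => x0
  | t + 1 => gdIter f η x0 t - η • gradient f (gdIter f η x0 t)


/-- `f` is `C²` and bounded by `K`, and its first two derivatives are `K`-Lipschitz. -/
structure SmoothBound {E : Type*} [NormedAddCommGroup E] [NormedSpace ℝ E]
    (K : ℝ) (f : E → ℝ) : Prop where
  contDiff : ContDiff ℝ 2 f
  bounded : ∀ x, |f x| ≤ K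
  fderiv_lipschitz : ∀ x y, ‖fderiv ℝ f x - fderiv ℝ f y‖ ≤ K * ‖x - y‖
  hessian_lipschitz : ∀ x y,
    ‖fderiv ℝ (fderiv ℝ f) x - fderiv ℝ (fderiv ℝ f) y‖ ≤ K * ‖x - y‖

namespace SmoothBound

variable {E : Type*} [NormedAddCommGroup E] [NormedSpace ℝ E]

theorem differentiable {K : ℝ} {f : E → ℝ} (hf : SmoothBound K f) : Differentiable ℝ f :=
  hf.contDiff.differentiable (by norm_num)

theorem differentiable_fderiv {K : ℝ} {f : E → ℝ} (hf : SmoothBound K f) :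
    Differentiable ℝ (fderiv ℝ f) :=
  (hf.contDiff.fderiv_right (m := 1) (by norm_num)).differentiable (by norm_num)

theorem mono {K K' : ℝ} {f : E → ℝ} (hf : SmoothBound K f) (h : K ≤ K') : SmoothBound K' f where
  contDiff := hf.contDiff
  bounded x := (hf.bounded x).trans h
  fderiv_lipschitz x y :=
    (hf.fderiv_lipschitz x y).trans (mul_le_mul_of_nonneg_right h (norm_nonneg _))
  hessian_lipschitz x y :=
    (hf.hessian_lipschitz x y).trans (mul_le_mul_of_nonneg_right h (norm_nonneg _))

theorem add {K K' : ℝ} {f g : E → ℝ} (hf : SmoothBound K f) (hg : SmoothBound K' g) :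
    SmoothBound (K + K') (fun x => f x + g x) := by
  have h1 : fderiv ℝ (fun x => f x + g x) = fun x => fderiv ℝ f x + fderiv ℝ g x := by
    funext x
    exact fderiv_fun_add (hf.differentiable x) (hg.differentiable x)
  have h2 : fderiv ℝ (fderiv ℝ (fun x => f x + g x)) =
      fun x => fderiv ℝ (fderiv ℝ f) x + fderiv ℝ (fderiv ℝ g) x := by
    funext x
    rw [h1]
    exact fderiv_fun_add (hf.differentiable_fderiv x) (hg.differentiable_fderiv x)
  refine ⟨hf.contDiff.add hg.contDiff, fun x => ?_, fun x y => ?_, fun x y => ?_⟩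
  · exact (abs_add_le _ _).trans (add_le_add (hf.bounded x) (hg.bounded x))
  · rw [h1, add_mul, add_sub_add_comm]
    exact (norm_add_le _ _).trans
      (add_le_add (hf.fderiv_lipschitz x y) (hg.fderiv_lipschitz x y))
  · rw [h2, add_mul]
    beta_reduce
    rw [add_sub_add_comm]
    exact norm_add_le_of_le (E := E →L[ℝ] E →L[ℝ] ℝ)
      (hf.hessian_lipschitz x y) (hg.hessian_lipschitz x y)

theorem const_mul {K : ℝ} {f : E → ℝ} (hf : SmoothBound K f) (c : ℝ) :
    SmoothBound (|c| * K) (fun x => c * f x) := by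
  have h1 : fderiv ℝ (fun x => c * f x) = fun x => c • fderiv ℝ f x := by
    funext x
    exact fderiv_const_mul (hf.differentiable x) c
  have h2 : fderiv ℝ (fderiv ℝ (fun x => c * f x)) =
      fun x => c • fderiv ℝ (fderiv ℝ f) x := by
    funext x
    rw [h1]
    exact fderiv_fun_const_smul (hf.differentiable_fderiv x) c
  refine ⟨contDiff_const.mul hf.contDiff, fun x => ?_, fun x y => ?_, fun x y => ?_⟩
  · rw [abs_mul]
    exact mul_le_mul_of_nonneg_left (hf.bounded x) (abs_nonneg c)
  · rw [h1, ← smul_sub, norm_smul, mul_assoc, Real.norm_eq_abs]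
    exact mul_le_mul_of_nonneg_left (hf.fderiv_lipschitz x y) (abs_nonneg c)
  · rw [h2]
    beta_reduce
    rw [← smul_sub (A := E →L[ℝ] E →L[ℝ] ℝ), mul_assoc]
    exact (ContinuousLinearMap.opNorm_smul_le _ _).trans
      (mul_le_mul_of_nonneg_left (hf.hessian_lipschitz x y) (abs_nonneg c))

theorem zero : SmoothBound 0 (fun _ : E => (0 : ℝ)) := by
  have h1 : fderiv ℝ (fun _ : E => (0 : ℝ)) = fun _ => 0 := by
    funext x
    simp
  refine ⟨contDiff_const, by simp, fun x y => by simp, fun x y => ?_⟩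
  rw [h1, fderiv_fun_const, Pi.zero_apply, Pi.zero_apply, sub_zero, zero_mul]
  exact (norm_zero (E := E →L[ℝ] E →L[ℝ] ℝ)).le

theorem sum_range {K : ℝ} {f : ℕ → E → ℝ} (hf : ∀ n, SmoothBound K (f n)) (N : ℕ) :
    SmoothBound (N * K) (fun x => ∑ n ∈ Finset.range N, f n x) := by
  induction N with
  | zero => simpa using zero
  | succ N ih =>
    have h := ih.add (hf N)
    simp only [Finset.sum_range_succ]
    convert h using 1
    push_cast
    ring

theorem cos_affine (φ : ℝ) (L : E →L[ℝ] ℝ) (hL : ‖L‖ ≤ 1) :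
    SmoothBound 1 (fun x => Real.cos (φ + L x)) := by
  have hA : ∀ x, HasFDerivAt (fun x => φ + L x) L x := fun x => L.hasFDerivAt.const_add φ
  have h1 : fderiv ℝ (fun x => Real.cos (φ + L x)) = fun x => (-Real.sin (φ + L x)) • L := by
    funext x
    exact (hA x).cos.fderiv
  have h2 : fderiv ℝ (fderiv ℝ (fun x => Real.cos (φ + L x))) =
      fun x => (-(Real.cos (φ + L x) • L)).smulRight L := by
    funext x
    rw [h1]
    exact ((hA x).sin.neg.smul_const L).fderiv
  have hLxy : ∀ x y, |(φ + L x) - (φ + L y)| ≤ ‖x - y‖ := by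
    intro x y
    rw [add_sub_add_left_eq_sub, ← map_sub, ← Real.norm_eq_abs]
    exact (L.le_opNorm _).trans (mul_le_of_le_one_left (norm_nonneg _) hL)
  refine ⟨by fun_prop, fun x => Real.abs_cos_le_one _, fun x y => ?_, fun x y => ?_⟩
  · rw [h1, ← sub_smul, norm_smul, one_mul, Real.norm_eq_abs]
    have h3 : |-Real.sin (φ + L x) - -Real.sin (φ + L y)| ≤ ‖x - y‖ := by
      rw [neg_sub_neg, abs_sub_comm]
      exact (Real.abs_sin_sub_sin_le _ _).trans (hLxy x y)
    exact (mul_le_mul h3 hL (norm_nonneg _) (norm_nonneg _)).trans_eq (mul_one _)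
  · have h3 : |Real.cos (φ + L x) - Real.cos (φ + L y)| ≤ ‖x - y‖ :=
      (Real.abs_cos_sub_cos_le _ _).trans (hLxy x y)
    have h4 : (-(Real.cos (φ + L x) • L)).smulRight L - (-(Real.cos (φ + L y) • L)).smulRight L
        = ((Real.cos (φ + L y) - Real.cos (φ + L x)) • L).smulRight L := by
      ext v w
      simp
      ring
    rw [h2]
    beta_reduce
    rw [h4, ContinuousLinearMap.norm_smulRight_apply, norm_smul, one_mul, Real.norm_eq_abs,
      abs_sub_comm]
    calc _ ≤ ‖x - y‖ * 1 * 1 := by gcongr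
      _ = _ := by ring

end SmoothBound

theorem abs_add_mul_sin_mul_le {h θ r s : ℝ} (hh : 0 ≤ h) (hh' : h ≤ 1 / 4) (hθ : |θ| ≤ 1 / 2)
    (hr : -3 ≤ r) (hs : r ≤ s ∧ 0 ≤ s ∨ r ≤ 4 * s ∧ s ≤ 0) :
    |θ + h * Real.sin θ * r| ≤ (1 + h * s) * |θ| := by
  wlog hpos : 0 ≤ θ generalizing θ
  · have := this (θ := -θ) (by rwa [abs_neg]) (by linarith)
    rw [Real.sin_neg, abs_neg] at this
    rwa [← abs_neg, neg_add, ← neg_mul, ← mul_neg]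
  rw [abs_of_nonneg hpos] at hθ ⊢
  have h1 : Real.sin θ ≤ θ := Real.sin_le hpos
  have h2 : θ / 4 ≤ Real.sin θ := by
    rcases hpos.eq_or_lt with rfl | h0
    · simp
    · have := Real.sin_gt_sub_cube h0
      have h3 : θ ^ 2 ≤ 1 / 4 := by nlinarith
      nlinarith [mul_le_mul_of_nonneg_left h3 hpos]
  have h3 : 0 ≤ Real.sin θ := by linarith
  have h4 : -θ ≤ h * Real.sin θ * r := by
    have : h * Real.sin θ ≤ 1 / 4 * θ := mul_le_mul hh' h1 h3 (by norm_num)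
    have h0 : 0 ≤ h * Real.sin θ := mul_nonneg hh h3
    nlinarith
  have h5 : Real.sin θ * r ≤ s * θ := by
    rcases hs with ⟨hs, hs0⟩ | ⟨hs, hs0⟩ <;> nlinarith
  have h6 : h * (Real.sin θ * r) ≤ h * (s * θ) := mul_le_mul_of_nonneg_left h5 hh
  rw [abs_of_nonneg (by linarith)]
  linarith

theorem Real.seven_eighths_le_cos {θ : ℝ} (hθ : |θ| ≤ 1 / 2) : 7 / 8 ≤ Real.cos θ := by
  have := Real.one_sub_sq_div_two_le_cos (x := θ)
  have h2 : θ ^ 2 ≤ (1 / 2) ^ 2 := sq_le_sq' (by linarith [neg_abs_le θ]) ((le_abs_self θ).trans hθ)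
  linarith

/-- In the chain dynamics the first `k` coordinates need at least `2 ^ k` steps to leave, and
until then all later coordinates remain close to the unstable equilibrium. -/
theorem chain_stays_small {h : ℝ} (hh : 0 ≤ h) (hh' : h ≤ 1 / 4) {a : ℕ → ℕ → ℝ}
    (hrec : ∀ t j, a (t + 1) (j + 1) = a t (j + 1) + h * Real.sin (a t (j + 1)) *
      (1 / 4 - Real.cos (a t j) - Real.cos (a t (j + 2))))
    (hinit : ∀ j, |a 0 (j + 1)| ≤ 1 / 4) (k : ℕ) :
    ∀ t ≤ 2 ^ k, ∀ j, k ≤ j → |a t (j + 1)| ≤ 1 / 2 := by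
  have hlow : ∀ t j, -3 ≤ 1 / 4 - Real.cos (a t j) - Real.cos (a t (j + 2)) := fun t j => by
    linarith [Real.cos_le_one (a t j), Real.cos_le_one (a t (j + 2))]
  induction k with
  | zero =>
    intro t ht j _
    have h0 := hinit j
    interval_cases t
    · linarith
    · rw [hrec]
      have hr : 1 / 4 - Real.cos (a 0 j) - Real.cos (a 0 (j + 2)) ≤ 3 := by
        linarith [Real.neg_one_le_cos (a 0 j), Real.neg_one_le_cos (a 0 (j + 2))]
      refine (abs_add_mul_sin_mul_le hh hh' (by linarith) (hlow 0 j)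
        (Or.inl ⟨hr, by norm_num⟩)).trans ?_
      nlinarith [abs_nonneg (a 0 (j + 1))]
  | succ k ih =>
    have hcon : ∀ t ≤ 2 ^ k, ∀ j, k + 1 ≤ j → |a t (j + 1)| ≤ (1 + h * -(3 / 8)) ^ t * (1 / 4) := by
      intro t
      induction t with
      | zero =>
        intro _ j _
        simpa using hinit j
      | succ t iht =>
        intro ht j hj
        obtain ⟨i, rfl⟩ : ∃ i, j = i + 1 := ⟨j - 1, by omega⟩
        have c1 := Real.seven_eighths_le_cos (ih t (by omega) i (by omega))
        have c2 := Real.seven_eighths_le_cos (ih t (by omega) (i + 2) (by omega))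
        rw [hrec]
        refine (abs_add_mul_sin_mul_le (s := -(3 / 8)) hh hh' (ih t (by omega) _ (by omega))
          (hlow t _) (Or.inr ⟨by linarith, by norm_num⟩)).trans ?_
        rw [pow_succ', mul_assoc]
        exact mul_le_mul_of_nonneg_left (iht (by omega) _ hj) (by linarith)
    have hprod : ∀ i ≤ 2 ^ k, (1 + h * (3 / 8)) ^ i * (1 + h * -(3 / 8)) ^ (2 ^ k) ≤ 1 := by
      intro i hi
      calc (1 + h * (3 / 8)) ^ i * (1 + h * -(3 / 8)) ^ (2 ^ k)
          ≤ (1 + h * (3 / 8)) ^ (2 ^ k) * (1 + h * -(3 / 8)) ^ (2 ^ k) :=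
            mul_le_mul_of_nonneg_right (pow_le_pow_right₀ (by nlinarith) hi)
              (pow_nonneg (by linarith) _)
        _ = ((1 + h * (3 / 8)) * (1 + h * -(3 / 8))) ^ (2 ^ k) := (mul_pow _ _ _).symm
        _ ≤ 1 := pow_le_one₀ (mul_nonneg (by linarith) (by linarith))
            (by nlinarith [mul_nonneg hh hh])
    have hgrow : ∀ i ≤ 2 ^ k, ∀ j, k + 1 ≤ j →
        |a (2 ^ k + i) (j + 1)| ≤ (1 + h * (3 / 8)) ^ i * (1 + h * -(3 / 8)) ^ (2 ^ k) * (1 / 4) := by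
      intro i
      induction i with
      | zero =>
        intro _ j hj
        simpa using hcon _ le_rfl j hj
      | succ i ihi =>
        intro hi j hj
        have hsmall : ∀ j, k + 1 ≤ j → |a (2 ^ k + i) (j + 1)| ≤ 1 / 2 := fun j hj => by
          linarith [ihi (by omega) j hj, hprod i (by omega)]
        have c2 := Real.seven_eighths_le_cos (hsmall (j + 1) (by omega))
        have c1 := Real.neg_one_le_cos (a (2 ^ k + i) j)
        rw [← add_assoc, hrec]
        refine (abs_add_mul_sin_mul_le (s := 3 / 8) hh hh' (hsmall j hj) (hlow _ _)
          (Or.inl ⟨by linarith, by norm_num⟩)).trans ?_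
        rw [pow_succ', mul_assoc, mul_assoc, ← mul_assoc (_ ^ i)]
        exact mul_le_mul_of_nonneg_left (ihi (by omega) _ hj) (by linarith)
    intro t ht j hj
    rcases le_total t (2 ^ k) with h1 | h1
    · exact ih t h1 j (by omega)
    · obtain ⟨i, rfl⟩ := Nat.exists_eq_add_of_le h1
      have hi : i ≤ 2 ^ k := by rw [pow_succ] at ht; omega
      linarith [hgrow i hi j hj, hprod i hi]

/-- The linear part of the `n`-th angle of the chain on `ℝ^d`: a multiple of the coordinate
`n - 1` when there is one, and zero otherwise. -/
noncomputable def chainLinear (d : ℕ) : ℕ → (EuclideanSpace ℝ (Fin d) →L[ℝ] ℝ)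
  | 0 => 0
  | n + 1 => if h : n < d then (1 / 4 : ℝ) • EuclideanSpace.proj ⟨n, h⟩ else 0

/-- The constant part of the angles of the chain: the left end is pinned at `π`. -/
noncomputable def chainOffset (n : ℕ) : ℝ := if n = 0 then Real.pi else 0

/-- The `n`-th angle of the chain. -/
noncomputable def chainAngle (d n : ℕ) (x : EuclideanSpace ℝ (Fin d)) : ℝ :=
  chainOffset n + chainLinear d n x

/-- Energy of a ferromagnetic chain of `d` angles in a weak external field, with left end pinned
at `π` and right end pinned at `0`. -/
noncomputable def chainEnergy (d : ℕ) (x : EuclideanSpace ℝ (Fin d)) : ℝ :=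
  ∑ n ∈ Finset.range (d + 1), (1 / 4 * Real.cos (chainAngle d n x) -
    Real.cos (chainAngle d n x) * Real.cos (chainAngle d (n + 1) x))

theorem norm_chainLinear_le (d n : ℕ) : ‖chainLinear d n‖ ≤ 1 / 4 := by
  rcases n with _ | n
  · simp [chainLinear]
  · rw [chainLinear]
    split_ifs with h
    · refine ContinuousLinearMap.opNorm_le_bound _ (by norm_num) fun x => ?_
      have := PiLp.norm_apply_le x ⟨n, h⟩
      simpa [norm_smul] using this
    · simp

theorem chainLinear_single {d : ℕ} (k : Fin d) (n : ℕ) :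
    chainLinear d n (EuclideanSpace.single k 1) = if n = k + 1 then 1 / 4 else 0 := by
  rcases n with _ | n
  · simp [chainLinear]
  · rw [chainLinear]
    split_ifs with h h' h'
    · simp at h'
      simp [h']
    · have : (⟨n, h⟩ : Fin d) ≠ k := by
        rintro rfl
        exact h' rfl
      simp [this]
    · exact absurd k.2 (by omega)
    · simp

theorem chainAngle_succ {d : ℕ} (k : Fin d) (x : EuclideanSpace ℝ (Fin d)) :
    chainAngle d (k + 1) x = 1 / 4 * x k := by
  simp [chainAngle, chainOffset, chainLinear]

theorem chainAngle_of_lt {d n : ℕ} (h : d < n) (x : EuclideanSpace ℝ (Fin d)) :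
    chainAngle d n x = 0 := by
  obtain ⟨m, rfl⟩ : ∃ m, n = m + 1 := ⟨n - 1, by omega⟩
  simp [chainAngle, chainOffset, chainLinear, show ¬ m < d by omega]

theorem chainAngle_zero (d : ℕ) (x : EuclideanSpace ℝ (Fin d)) :
    chainAngle d 0 x = Real.pi := by
  simp [chainAngle, chainOffset, chainLinear]

theorem hasFDerivAt_chainAngle (d n : ℕ) (x : EuclideanSpace ℝ (Fin d)) :
    HasFDerivAt (chainAngle d n) (chainLinear d n) x :=
  (chainLinear d n).hasFDerivAt.const_add (chainOffset n)

theorem smoothBound_chainEnergy (d : ℕ) : SmoothBound (2 * (d + 1) : ℝ) (chainEnergy d) := by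
  have key : ∀ n, SmoothBound (2 : ℝ) (fun x => 1 / 4 * Real.cos (chainAngle d n x) -
      Real.cos (chainAngle d n x) * Real.cos (chainAngle d (n + 1) x)) := by
    intro n
    have h0 := norm_chainLinear_le d n
    have h1 := norm_chainLinear_le d (n + 1)
    have s1 := (SmoothBound.cos_affine (chainOffset n) (chainLinear d n)
      (by linarith)).const_mul (1 / 4)
    have s2 := (SmoothBound.cos_affine (chainOffset n + chainOffset (n + 1))
      (chainLinear d n + chainLinear d (n + 1))
      ((norm_add_le _ _).trans (by linarith))).const_mul (-(1 / 2))
    have s3 := (SmoothBound.cos_affine (chainOffset n - chainOffset (n + 1))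
      (chainLinear d n - chainLinear d (n + 1))
      ((norm_sub_le _ _).trans (by linarith))).const_mul (-(1 / 2))
    have hsum := (s1.add (s2.add s3)).mono (K' := 2) (by norm_num [abs_of_pos])
    refine cast (congrArg _ (funext fun x => ?_)) hsum
    have e1 : chainOffset n + chainLinear d n x = chainAngle d n x := rfl
    have e2 : chainOffset n + chainOffset (n + 1) + (chainLinear d n + chainLinear d (n + 1)) x =
        chainAngle d n x + chainAngle d (n + 1) x := by
      simp only [chainAngle, add_apply]
      ring
    have e3 : chainOffset n - chainOffset (n + 1) + (chainLinear d n - chainLinear d (n + 1)) x =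
        chainAngle d n x - chainAngle d (n + 1) x := by
      simp only [chainAngle, sub_apply]
      ring
    rw [e1, e2, e3, Real.cos_add, Real.cos_sub]
    ring
  have := SmoothBound.sum_range key (d + 1)
  rw [mul_comm, ← Nat.cast_add_one]
  exact this

theorem fderiv_chainEnergy_single {d : ℕ} (k : Fin d) (x : EuclideanSpace ℝ (Fin d)) :
    fderiv ℝ (chainEnergy d) x (EuclideanSpace.single k 1) =
      -(1 / 4) * (Real.sin (chainAngle d (k + 1) x) *
        (1 / 4 - Real.cos (chainAngle d k x) - Real.cos (chainAngle d (k + 2) x))) := by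
  have h : HasFDerivAt (chainEnergy d) _ x := HasFDerivAt.fun_sum fun n _ =>
    ((hasFDerivAt_chainAngle d n x).cos.const_mul (1 / 4)).sub
      ((hasFDerivAt_chainAngle d n x).cos.mul (hasFDerivAt_chainAngle d (n + 1) x).cos)
  rw [h.fderiv]
  have hk : (k : ℕ) < d + 1 := by omega
  simp [chainLinear_single, Finset.sum_add_distrib,
    Finset.sum_sub_distrib, hk]
  ring

theorem fderiv_fderiv_chainEnergy_single {d : ℕ} (k : Fin d) (x : EuclideanSpace ℝ (Fin d)) :
    fderiv ℝ (fderiv ℝ (chainEnergy d)) x (EuclideanSpace.single k 1)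
        (EuclideanSpace.single k 1) =
      -(1 / 16) * (Real.cos (chainAngle d (k + 1) x) *
        (1 / 4 - Real.cos (chainAngle d k x) - Real.cos (chainAngle d (k + 2) x))) := by
  have h1 := ((smoothBound_chainEnergy d).differentiable_fderiv x).hasFDerivAt.clm_apply
    (hasFDerivAt_const (EuclideanSpace.single k (1 : ℝ)) x)
  simp only [fderiv_chainEnergy_single] at h1
  have h2 := ((hasFDerivAt_chainAngle d (k + 1) x).sin.mul
    (((hasFDerivAt_chainAngle d k x).cos.const_sub (1 / 4)).sub
      (hasFDerivAt_chainAngle d (k + 2) x).cos)).const_mul (-(1 / 4))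
  have h3 := congrArg (fun T => T (EuclideanSpace.single k (1 : ℝ))) (h1.unique h2)
  simp [chainLinear_single] at h3
  rw [h3]
  ring

theorem gradient_chainEnergy_apply {d : ℕ} (k : Fin d) (x : EuclideanSpace ℝ (Fin d)) :
    gradient (chainEnergy d) x k = -(1 / 4) * (Real.sin (chainAngle d (k + 1) x) *
        (1 / 4 - Real.cos (chainAngle d k x) - Real.cos (chainAngle d (k + 2) x))) := by
  rw [← fderiv_chainEnergy_single, ← toDual_gradient, InnerProductSpace.toDual_apply_apply,
    EuclideanSpace.inner_single_right]
  simp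

/-- A point at which the last angle of the chain has not passed `π / 2` is not an approximate
second-order stationary point: at the first angle that is not close to `π` there is either a
large partial derivative or strong negative curvature. -/
theorem chainEnergy_large_gradient_or_negative_curvature {d : ℕ} (x : EuclideanSpace ℝ (Fin d))
    (hx : 0 ≤ Real.cos (chainAngle d d x)) :
    ∃ k : Fin d, 1 / 100 < |gradient (chainEnergy d) x k| ∨
      fderiv ℝ (fderiv ℝ (chainEnergy d)) x (EuclideanSpace.single k 1)
        (EuclideanSpace.single k 1) ≤ -(1 / 256) := by
  classical
  have hex : ∃ n, -(7 / 8) < Real.cos (chainAngle d n x) := ⟨d, by linarith⟩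
  obtain ⟨m, hm, hmin⟩ : ∃ m, -(7 / 8) < Real.cos (chainAngle d m x) ∧
      ∀ n < m, Real.cos (chainAngle d n x) ≤ -(7 / 8) :=
    ⟨Nat.find hex, Nat.find_spec hex, fun n hn => not_lt.1 (Nat.find_min hex hn)⟩
  have hmd : m ≤ d := by
    by_contra h
    linarith [hmin d (by omega)]
  rcases m with _ | k
  · rw [chainAngle_zero, Real.cos_pi] at hm
    norm_num at hm
  have hk : k < d := by omega
  have hprev := hmin k (by omega)
  refine ⟨⟨k, hk⟩, ?_⟩
  rw [fderiv_fderiv_chainEnergy_single, gradient_chainEnergy_apply]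
  simp only
  set r := 1 / 4 - Real.cos (chainAngle d k x) - Real.cos (chainAngle d (k + 2) x) with hr_def
  set θ := chainAngle d (k + 1) x
  have hr : 1 / 8 ≤ r := by linarith [Real.cos_le_one (chainAngle d (k + 2) x)]
  rcases le_total (1 / 2) (Real.cos θ) with hc | hc
  · right
    nlinarith
  · left
    have hsin : 2 / 5 < |Real.sin θ| := by
      refine lt_of_pow_lt_pow_left₀ 2 (abs_nonneg _) ?_
      rw [sq_abs, Real.sin_sq]
      nlinarith
    rw [abs_mul, abs_mul, abs_of_nonneg (by linarith : 0 ≤ r), abs_neg,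
      abs_of_nonneg (by norm_num : (0 : ℝ) ≤ 1 / 4)]
    nlinarith

theorem cos_chainAngle_gdIter_nonneg {d : ℕ} (hd : 0 < d) {η : ℝ} (hη : 0 ≤ η) (hη' : η ≤ 1)
    {x₀ : EuclideanSpace ℝ (Fin d)} (hx₀ : ∀ i, x₀ i ∈ Set.Icc (-1 : ℝ) 1) {t : ℕ}
    (ht : t ≤ 2 ^ (d - 1)) :
    0 ≤ Real.cos (chainAngle d d (gdIter (chainEnergy d) η x₀ t)) := by
  have hrec : ∀ t j, chainAngle d (j + 1) (gdIter (chainEnergy d) η x₀ (t + 1)) =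
      chainAngle d (j + 1) (gdIter (chainEnergy d) η x₀ t) +
        η / 16 * Real.sin (chainAngle d (j + 1) (gdIter (chainEnergy d) η x₀ t)) *
        (1 / 4 - Real.cos (chainAngle d j (gdIter (chainEnergy d) η x₀ t)) -
          Real.cos (chainAngle d (j + 2) (gdIter (chainEnergy d) η x₀ t))) := by
    intro t j
    rcases lt_or_ge j d with hj | hj
    · have h1 := chainAngle_succ ⟨j, hj⟩ (gdIter (chainEnergy d) η x₀ (t + 1))
      have h2 := chainAngle_succ ⟨j, hj⟩ (gdIter (chainEnergy d) η x₀ t)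
      have h3 := gradient_chainEnergy_apply ⟨j, hj⟩ (gdIter (chainEnergy d) η x₀ t)
      rw [gdIter, PiLp.sub_apply, PiLp.smul_apply, h3, smul_eq_mul, mul_sub, ← h2, ← gdIter] at h1
      refine h1.trans ?_
      ring
    · simp [chainAngle_of_lt (Nat.lt_succ_of_le hj)]
  have hinit : ∀ j, |chainAngle d (j + 1) (gdIter (chainEnergy d) η x₀ 0)| ≤ 1 / 4 := by
    intro j
    rcases lt_or_ge j d with hj | hj
    · have h2 := chainAngle_succ ⟨j, hj⟩ x₀
      have h3 := hx₀ ⟨j, hj⟩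
      refine (congrArg abs h2).trans_le (abs_le.2 ⟨?_, ?_⟩) <;> linarith [h3.1, h3.2]
    · simp [chainAngle_of_lt (Nat.lt_succ_of_le hj)]
  have h := chain_stays_small
    (a := fun t n => chainAngle d n (gdIter (chainEnergy d) η x₀ t)) (h := η / 16)
    (by linarith) (by linarith) hrec hinit (d - 1) t ht (d - 1) le_rfl
  rw [Nat.sub_add_cancel hd] at h
  linarith [Real.seven_eighths_le_cos h]

theorem exp_le_two_pow {d : ℕ} (hd : 2 ≤ d) : Real.exp (1 / 4 * d) ≤ (2 : ℝ) ^ (d - 1) := by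
  have hd' : (2 : ℝ) ≤ d := by exact_mod_cast hd
  rw [← Real.exp_log (by positivity : (0 : ℝ) < 2 ^ (d - 1)), Real.exp_le_exp, Real.log_pow,
    Nat.cast_sub (by omega)]
  have := Real.log_two_gt_d9
  push_cast
  nlinarith

/-- for all large `d` there are a poly(d)-smooth `C²` function on `ℝ^d` and
`ε ≥ 1/poly(d)` such that, from a uniformly random initialization in `[-1,1]^d`, almost
surely no GD iterate within `e^{cd}` steps (for any step size `η ≤ 1/ℓ`) is an
`ε`-second-order stationary point, i.e. satisfies both `‖∇f(x)‖ ≤ ε` and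
`λ_min(∇²f(x)) ≥ -√(ρε)`. -/
theorem stmt_1 :
    ∃ c : ℝ, 0 < c ∧ ∃ C : ℝ, 0 < C ∧ ∃ d₀ : ℕ, ∀ d : ℕ, d₀ ≤ d →
    ∃ (f : EuclideanSpace ℝ (Fin d) → ℝ) (B ℓ ρ ε : ℝ),
      0 < B ∧ 0 < ℓ ∧ 0 < ρ ∧
      ContDiff ℝ 2 f ∧
      (∀ x, |f x| ≤ B) ∧
      (∀ x y, ‖gradient f x - gradient f y‖ ≤ ℓ * ‖x - y‖) ∧
      (∀ x y, ‖fderiv ℝ (fderiv ℝ f) x - fderiv ℝ (fderiv ℝ f) y‖ ≤ ρ * ‖x - y‖) ∧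
      B ≤ C * (d:ℝ)^C ∧ ℓ ≤ C * (d:ℝ)^C ∧ ρ ≤ C * (d:ℝ)^C ∧
      1/(C * (d:ℝ)^C) ≤ ε ∧ 0 < ε ∧
      ∀ η : ℝ, 0 < η → η ≤ 1/ℓ →
        ∀ᵐ x0 ∂(MeasureTheory.volume[|{x : EuclideanSpace ℝ (Fin d) |
            ∀ i, x i ∈ Set.Icc (-1:ℝ) 1}]),
          ∀ t : ℕ, (t:ℝ) ≤ Real.exp (c * d) →
            ¬ (‖gradient f (gdIter f η x0 t)‖ ≤ ε ∧
              ∀ v : EuclideanSpace ℝ (Fin d),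
                -(Real.sqrt (ρ*ε)) * ‖v‖^2 ≤ fderiv ℝ (fderiv ℝ f) (gdIter f η x0 t) v v) := by
  refine ⟨1 / 4, by norm_num, 2 ^ 20, by norm_num, 2, fun d hd => ?_⟩
  have hd' : (2 : ℝ) ≤ d := by exact_mod_cast hd
  set K : ℝ := 2 * (d + 1) with hK_def
  have hK : 6 ≤ K := by linarith
  have hf : SmoothBound K (chainEnergy d) := smoothBound_chainEnergy d
  have hpow : (d : ℝ) ≤ (d : ℝ) ^ ((2 : ℝ) ^ 20) :=
    Real.self_le_rpow_of_one_le (by linarith) (by norm_num)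
  have hKC : K ≤ 2 ^ 20 * (d : ℝ) ^ ((2 : ℝ) ^ 20) := by linarith
  have hε : 0 < 1 / (2 ^ 17 * K) := by positivity
  refine ⟨chainEnergy d, K, K, K, 1 / (2 ^ 17 * K), by linarith, by linarith, by linarith,
    hf.contDiff, hf.bounded, fun x y => ?_, hf.hessian_lipschitz, hKC, hKC, hKC,
    ?_, hε, fun η hη hη' => ?_⟩
  · rw [← LinearIsometryEquiv.norm_map (InnerProductSpace.toDual ℝ _), map_sub, toDual_gradient,
      toDual_gradient]
    exact hf.fderiv_lipschitz x y
  · exact one_div_le_one_div_of_le (by positivity) (by linarith)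
  have hmeas : MeasurableSet {x : EuclideanSpace ℝ (Fin d) | ∀ i, x i ∈ Set.Icc (-1 : ℝ) 1} := by
    simp only [Set.ofPred_forall]
    exact MeasurableSet.iInter fun i => measurableSet_Icc.preimage (by fun_prop)
  filter_upwards [ae_cond_mem hmeas] with x₀ hx₀ t ht
  have ht' : t ≤ 2 ^ (d - 1) := by exact_mod_cast ht.trans (exp_le_two_pow hd)
  have hη1 : η ≤ 1 := hη'.trans ((div_le_one (by linarith)).2 (by linarith))
  rintro ⟨hgrad, hhess⟩
  obtain ⟨k, hk | hk⟩ := chainEnergy_large_gradient_or_negative_curvature _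
    (cos_chainAngle_gdIter_nonneg (by omega) hη.le hη1 hx₀ ht')
  · have h1 := (PiLp.norm_apply_le (gradient (chainEnergy d) (gdIter (chainEnergy d) η x₀ t))
      k).trans hgrad
    rw [Real.norm_eq_abs] at h1
    have h2 : 1 / (2 ^ 17 * K) ≤ 1 / 100 :=
      one_div_le_one_div_of_le (by norm_num) (by linarith)
    linarith
  · have h1 := hhess (EuclideanSpace.single k 1)
    have h2 : √(K * (1 / (2 ^ 17 * K))) < 1 / 256 := by
      rw [Real.sqrt_lt' (by norm_num)]
      field_simp
      norm_num
    rw [PiLp.norm_single, norm_one] at h1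
    linarith
end

section
/- Let L ≥ γ > 0, let 0 < η ≤ 1/(2L), let x ∈ ℝ with 0 < x ≤ 1, and let t₁, t₂ be natural numbers with t₁ ≤ t₂. If (1 + 2ηγ)^{t₂ − t₁} · (1 − 2ηL)^{t₁} · x ≥ 1, then t₂ ≥ ((L + γ)/γ) · t₁. -/
/-- the key escape-time comparison inequality. -/
theorem stmt_8 (L γ η x : ℝ) (t1 t2 : ℕ) (hγ : 0 < γ) (hLγ : γ ≤ L)
    (hη0 : 0 < η) (hη : η ≤ 1/(2*L)) (hx0 : 0 < x) (hx1 : x ≤ 1) (ht : t1 ≤ t2)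
    (h : 1 ≤ (1 + 2*η*γ)^(t2 - t1) * (1 - 2*η*L)^t1 * x) :
    ((L + γ)/γ) * (t1 : ℝ) ≤ (t2 : ℝ) := by
  have hL : 0 < L := hγ.trans_le hLγ
  have hηL : 0 ≤ 1 - 2*η*L := by
    rw [le_div_iff₀ (by positivity)] at hη
    linarith
  have hup : (1 + 2*η*γ)^(t2 - t1) ≤ Real.exp (((t2 - t1 : ℕ) : ℝ) * (2*η*γ)) := by
    rw [Real.exp_nat_mul]
    gcongr
    linarith [Real.add_one_le_exp (2*η*γ)]
  have hdown : (1 - 2*η*L)^t1 ≤ Real.exp ((t1 : ℝ) * (-(2*η*L))) := by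
    rw [Real.exp_nat_mul]
    gcongr
    exact Real.one_sub_le_exp_neg _
  have hexp : 1 ≤ Real.exp (((t2 - t1 : ℕ) : ℝ) * (2*η*γ) + (t1 : ℝ) * (-(2*η*L))) := by
    rw [Real.exp_add]
    calc 1 ≤ (1 + 2*η*γ)^(t2 - t1) * (1 - 2*η*L)^t1 * x := h
      _ ≤ (1 + 2*η*γ)^(t2 - t1) * (1 - 2*η*L)^t1 :=
        mul_le_of_le_one_right (by positivity) hx1
      _ ≤ _ := by gcongr
  rw [Real.one_le_exp_iff, Nat.cast_sub ht] at hexp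
  rw [div_mul_eq_mul_div, div_le_iff₀ hγ]
  have hfactor : 0 ≤ 2*η * ((t2 : ℝ) * γ - (L + γ) * t1) := by linarith
  linarith [nonneg_of_mul_nonneg_right hfactor (by positivity)]
end
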